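/- Let $\Phi$ be a Schwartz function on $\mathbb{R}^d$, set $\Phi_j(x)=2^{jd}\Phi(2^jx)$ for $j\in\mathbb{Z}$, and define $K_j(x,y)=\Phi_j(x-y)$. Then there is a constant $N=N(d,\Phi)$ such that for all $x\ne y$, $\big(\sum_{j\in\mathbb{Z}}|K_j(x,y)|^2\big)^{1/2}\le\frac{N}{|x-y|^d}$, and for all $x,x',y$ with $|x-x'|\le\frac{1}{2}\max\{|x-y|,|x'-y|\}$, $\big(\sum_{j\in\mathbb{Z}}|K_j(x,y)-K_j(x',y)|^2\big)^{1/2}\le\frac{N|x-x'|}{(|x-y|+|x'-y|)^{d+1}}$. -/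

import Mathlib

open MeasureTheory Metric Filter Set
open scoped ENNReal NNReal FourierTransform Topology Classical BigOperators

noncomputable section

/-- `d`-dimensional Euclidean space. -/
abbrev Rd (d : ℕ) := EuclideanSpace ℝ (Fin d)

/-- The Muckenhoupt `A_p` ratio of a weight `w` over the ball `B(c,r)`. -/
def apRatio {E : Type*} [NormedAddCommGroup E] [MeasureSpace E] (p : ℝ) (w : E → ℝ)
    (c : E) (r : ℝ) : ℝ :=
  (⨍ x in ball c r, w x) * (⨍ x in ball c r, (w x) ^ (-(1 : ℝ) / (p - 1))) ^ (p - 1)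

/-- `w` is a Muckenhoupt `A_p` weight: nonnegative, locally integrable, with the `A_p`
ratios uniformly bounded over all balls. -/
structure IsAp {E : Type*} [NormedAddCommGroup E] [MeasureSpace E] (p : ℝ) (w : E → ℝ) : Prop where
  nonneg : ∀ x, 0 ≤ w x
  locInt : LocallyIntegrable w volume
  bdd : BddAbove (Set.range fun cr : E × {r : ℝ // 0 < r} => apRatio p w cr.1 cr.2.1)

/-- The Muckenhoupt characteristic `[w]_p`. -/
def apConst {E : Type*} [NormedAddCommGroup E] [MeasureSpace E] (p : ℝ) (w : E → ℝ) : ℝ :=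
  ⨆ cr : E × {r : ℝ // 0 < r}, apRatio p w cr.1 cr.2.1

/-- The weighted `L_p` (quasi-)norm `‖u‖_{L_p(w)}`, valued in `ℝ≥0∞`. -/
def wLp {E : Type*} [NormedAddCommGroup E] [MeasureSpace E] (p : ℝ) (w : E → ℝ)
    (u : E → ℂ) : ℝ≥0∞ :=
  (∫⁻ x, (‖u x‖₊ : ℝ≥0∞) ^ p * ENNReal.ofReal (w x)) ^ (1 / p)

/-- The Bessel potential operator `(1-Δ)^{γ/2}`, as a Fourier multiplier. -/
def bessel {d : ℕ} (γ : ℝ) (u : Rd d → ℂ) : Rd d → ℂ :=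
  𝓕⁻ fun ξ : Rd d => (((1 : ℝ) + ‖ξ‖ ^ 2) ^ (γ / 2) : ℝ) • 𝓕 u ξ

/-- The Fourier multiplier `(λ - Δ)^{s}` with symbol `(λ + |ξ|²)^s`. -/
def besselL {d : ℕ} (lam s : ℝ) (u : Rd d → ℂ) : Rd d → ℂ :=
  𝓕⁻ fun ξ : Rd d => ((lam + ‖ξ‖ ^ 2) ^ s : ℝ) • 𝓕 u ξ

/-- The norm of the weighted Bessel-potential space `H^γ_p(w)`. -/
def hNorm {d : ℕ} (γ p : ℝ) (w : Rd d → ℝ) (u : Rd d → ℂ) : ℝ≥0∞ :=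
  wLp p w (bessel γ u)

/-- The norm of `𝔹H^γ_{q,p}(w₂,w₁,T) = L_q((0,T),w₂dt;H^γ_p(w₁))`. -/
def mixNorm {d : ℕ} (γ q p : ℝ) (w2 : ℝ → ℝ) (w1 : Rd d → ℝ) (T : ℝ)
    (u : ℝ → Rd d → ℂ) : ℝ≥0∞ :=
  (∫⁻ t in Set.Ioo (0 : ℝ) T, hNorm γ p w1 (u t) ^ q * ENNReal.ofReal (w2 t)) ^ (1 / q)

/-- Riemann-Liouville fractional integral `I^β_t`. -/
def RL (β : ℝ) (φ : ℝ → ℂ) (t : ℝ) : ℂ :=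
  (Real.Gamma β)⁻¹ • ∫ s in Set.Ioc (0 : ℝ) t, ((t - s) ^ (β - 1) : ℝ) • φ s

/-- Riemann-Liouville fractional integral for real valued functions. -/
def RLreal (β : ℝ) (φ : ℝ → ℝ) (t : ℝ) : ℝ :=
  (Real.Gamma β)⁻¹ * ∫ s in Set.Ioc (0 : ℝ) t, ((t - s) ^ (β - 1) : ℝ) * φ s

/-- The Caputo fractional derivative `∂^α_t` of order `α ∈ (0,2)`:
`∂^α_t φ = (d/dt)^n I^{n-α}(φ - ∑_{k<n} t^k/k! φ^{(k)}(0))`, with `n = 1` for `α < 1`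
and `n = 2` for `α > 1` (ordinary derivative for `α = 1`). -/
def caputo (α : ℝ) (φ : ℝ → ℂ) : ℝ → ℂ :=
  if α = 1 then deriv φ
  else
    let n : ℕ := if α < 1 then 1 else 2
    iteratedDeriv n (RL ((n : ℝ) - α) fun s =>
      φ s - ∑ k ∈ Finset.range n, ((s ^ k / (Nat.factorial k) : ℝ) : ℂ) * iteratedDeriv k φ 0)

/-- The Caputo derivative in time of a space-time function. -/
def caputoST {d : ℕ} (α : ℝ) (u : ℝ → Rd d → ℂ) : ℝ → Rd d → ℂ :=
  fun t x => caputo α (fun s => u s x) t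

/-- `u ∈ 𝔹H^{α,γ+2}_{q,p,0}(w₂,w₁,T)` with Caputo derivative `∂^α_t u = f`: there is a
sequence of smooth functions vanishing (together with `∂_t` if `α > 1`) at `t = 0`,
converging to `u` in `𝔹H^{γ+2}_{q,p}` whose Caputo derivatives converge to `f` in
`𝔹H^{γ}_{q,p}`. -/
def InSolSpace0 {d : ℕ} (α γ q p : ℝ) (w2 : ℝ → ℝ) (w1 : Rd d → ℝ) (T : ℝ)
    (u f : ℝ → Rd d → ℂ) : Prop :=
  mixNorm (γ + 2) q p w2 w1 T u < ⊤ ∧ mixNorm γ q p w2 w1 T f < ⊤ ∧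
  ∃ un : ℕ → ℝ → Rd d → ℂ,
    (∀ n, ContDiff ℝ (⊤ : ℕ∞) fun pa : ℝ × Rd d => un n pa.1 pa.2) ∧
    (∀ n x, un n 0 x = 0) ∧
    (1 < α → ∀ n x, deriv (fun t => un n t x) 0 = 0) ∧
    Tendsto (fun n => mixNorm (γ + 2) q p w2 w1 T fun t x => un n t x - u t x) atTop (𝓝 0) ∧
    Tendsto (fun n => mixNorm γ q p w2 w1 T fun t x => caputoST α (un n) t x - f t x)
      atTop (𝓝 0)

/-- First order spatial derivative `u_{x^i}`. -/
def dx {d : ℕ} (v : Rd d → ℂ) (i : Fin d) (x : Rd d) : ℂ :=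
  fderiv ℝ v x (EuclideanSpace.single i 1)

/-- Second order spatial derivative `u_{x^i x^j}`. -/
def dxx {d : ℕ} (v : Rd d → ℂ) (i j : Fin d) (x : Rd d) : ℂ :=
  fderiv ℝ (fun y => dx v j y) x (EuclideanSpace.single i 1)

/-- Supremum of the `k`-th derivative. -/
def supIFD {d : ℕ} (k : ℕ) (g : Rd d → ℝ) : ℝ≥0∞ :=
  ⨆ x : Rd d, (‖iteratedFDeriv ℝ k g x‖₊ : ℝ≥0∞)

/-- Hölder seminorm of exponent `σ` of the `k`-th derivative. -/
def holderSemi {d : ℕ} (σ : ℝ) (k : ℕ) (g : Rd d → ℝ) : ℝ≥0∞ :=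
  ⨆ pq : {pq : Rd d × Rd d // pq.1 ≠ pq.2},
    (‖iteratedFDeriv ℝ k g pq.1.1 - iteratedFDeriv ℝ k g pq.1.2‖₊ : ℝ≥0∞) /
      ENNReal.ofReal (‖pq.1.1 - pq.1.2‖ ^ σ)

/-- The smoothness order required for membership in `B^r` (with auxiliary `κ'`). -/
def Bsmooth (r κ' : ℝ) : ℕ :=
  if r = 0 then 0 else if ∃ m : ℕ, r = (m : ℝ) then ⌈r⌉₊ - 1 else ⌊r + κ'⌋₊

/-- The norm of the space `B^r`: `L_∞` for `r = 0`, `C^{r-1,1}` for `r` a positive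
integer, and the Hölder space `C^{r+κ'}` otherwise. -/
def Bnorm {d : ℕ} (r κ' : ℝ) (g : Rd d → ℝ) : ℝ≥0∞ :=
  if r = 0 then supIFD 0 g
  else if ∃ m : ℕ, r = (m : ℝ) then
    (∑ k ∈ Finset.range ⌈r⌉₊, supIFD k g) + holderSemi 1 (⌈r⌉₊ - 1) g
  else
    (∑ k ∈ Finset.range (⌊r + κ'⌋₊ + 1), supIFD k g) +
      holderSemi (r + κ' - (⌊r + κ'⌋₊ : ℝ)) ⌊r + κ'⌋₊ g

/-- Admissibility of the auxiliary Hölder parameter `κ'` for the space `B^r`: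
`κ' = 0` if `r` is an integer, and otherwise `κ' ∈ (0,1)` with `r + κ'` not an integer. -/
def ValidKappa (r κ' : ℝ) : Prop :=
  ((∃ m : ℕ, r = (m : ℝ)) → κ' = 0) ∧
  (¬(∃ m : ℕ, r = (m : ℝ)) → 0 < κ' ∧ κ' < 1 ∧ ¬∃ m : ℕ, r + κ' = (m : ℝ))

/-- Membership `g ∈ B^r` with norm at most `C`. -/
def MemB {d : ℕ} (r κ' : ℝ) (g : Rd d → ℝ) (C : ℝ) : Prop :=
  ContDiff ℝ (Bsmooth r κ') g ∧ Bnorm r κ' g ≤ ENNReal.ofReal C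

/-- Convolution of complex valued functions on `ℝ^d`. -/
def conv {d : ℕ} (f g : Rd d → ℂ) : Rd d → ℂ :=
  MeasureTheory.convolution f g (ContinuousLinearMap.mul ℂ ℂ) volume

/-- Dyadic dilate `Φ_j(x) = 2^{jd} Φ(2^j x)`. -/
def dyad {d : ℕ} (Φ : Rd d → ℂ) (j : ℤ) : Rd d → ℂ :=
  fun x => (((2 : ℝ) ^ (j * (d : ℤ)) : ℝ) : ℂ) * Φ (((2 : ℝ) ^ j) • x)

/-- If `2 ^ k ≤ r < 2 ^ (k + 1)` and `b` is bounded both by `C * (2 ^ j * r) ^ n` and by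
`C * (2 ^ j * r) ^ (-n)`, then it decays geometrically in `|j + k|`. -/
lemma le_two_mul_half_pow_natAbs {n : ℕ} (hn : n ≠ 0) {r C b : ℝ} (hC : 0 ≤ C)
    {j k : ℤ} (hk₁ : (2 : ℝ) ^ k ≤ r) (hk₂ : r < (2 : ℝ) ^ (k + 1))
    (h₁ : b ≤ C * ((2 : ℝ) ^ j * r) ^ n) (h₂ : ((2 : ℝ) ^ j * r) ^ n * b ≤ C) :
    b ≤ 2 * C * (1 / 2 : ℝ) ^ (j + k).natAbs := by
  have hj : (0 : ℝ) < 2 ^ j := by positivity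
  have hr : 0 < r := lt_of_lt_of_le (by positivity) hk₁
  have lower : (2 : ℝ) ^ (j + k) ≤ 2 ^ j * r := by
    rw [zpow_add₀ two_ne_zero]; gcongr
  have upper : 2 ^ j * r ≤ (2 : ℝ) ^ (j + k + 1) := by
    rw [add_assoc, zpow_add₀ two_ne_zero]; gcongr
  generalize 2 ^ j * r = s at *
  have hs : 0 < s := lt_of_lt_of_le (by positivity) lower
  rcases le_or_gt 0 (j + k) with hm | hm
  · obtain ⟨m, hm⟩ := Int.eq_ofNat_of_zero_le hm
    rw [hm] at lower ⊢
    rw [Int.natAbs_natCast]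
    rw [zpow_natCast] at lower
    have hone : 1 ≤ (2 : ℝ) ^ m := one_le_pow₀ one_le_two
    have hsn : (2 : ℝ) ^ m ≤ s ^ n := lower.trans (le_self_pow₀ (hone.trans lower) hn)
    rcases le_or_gt b 0 with hb | hb
    · exact hb.trans (by positivity)
    have : 2 ^ m * b ≤ C := (mul_le_mul_of_nonneg_right hsn hb.le).trans h₂
    rw [one_div, inv_pow, ← div_eq_mul_inv, le_div_iff₀ (by positivity)]
    linarith
  · obtain ⟨m, hm⟩ : ∃ m : ℕ, j + k = -((m : ℤ) + 1) := ⟨(j + k).natAbs - 1, by omega⟩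
    rw [hm] at upper ⊢
    have habs : (-((m : ℤ) + 1)).natAbs = m + 1 := by omega
    rw [show -((m : ℤ) + 1) + 1 = -(m : ℤ) by ring, zpow_neg, zpow_natCast, ← inv_pow] at upper
    have hone : s ≤ 1 := upper.trans (pow_le_one₀ (by norm_num) (by norm_num))
    have hsn : s ^ n ≤ (2⁻¹ : ℝ) ^ m := (pow_le_of_le_one hs.le hone hn).trans upper
    rw [habs, pow_succ, one_div]
    have := mul_le_mul_of_nonneg_left hsn hC
    linarith

lemma summable_quarter_pow_natAbs : Summable fun m : ℤ => (1 / 4 : ℝ) ^ m.natAbs := by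
  apply Summable.of_nat_of_neg <;>
    simpa using summable_geometric_of_lt_one (r := (4⁻¹ : ℝ)) (by norm_num) (by norm_num)

/-- A sequence which, at scale `r`, is dominated by `2 ^ (j * n) * min 1 ((2 ^ j * r) ^ (-2 * n))`
has `ℓ₂` norm at most a constant times `r ^ (-n)`. -/
lemma rpow_half_tsum_sq_le {n : ℕ} (hn : n ≠ 0) {r C : ℝ} (hr : 0 < r) (hC : 0 ≤ C)
    {a : ℤ → ℝ} (ha : ∀ j, 0 ≤ a j) (h₁ : ∀ j, a j ≤ C * ((2 : ℝ) ^ j) ^ n)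
    (h₂ : ∀ j, ((2 : ℝ) ^ j * r) ^ (2 * n) * a j ≤ C * ((2 : ℝ) ^ j) ^ n) :
    (∑' j, a j ^ 2) ^ ((1 : ℝ) / 2) ≤
      2 * C * √(∑' m : ℤ, (1 / 4 : ℝ) ^ m.natAbs) / r ^ n := by
  obtain ⟨k, hk₁, hk₂⟩ := exists_mem_Ico_zpow hr one_lt_two
  have hrn : 0 < r ^ n := by positivity
  have bound (j : ℤ) : a j ≤ 2 * C / r ^ n * (1 / 2 : ℝ) ^ (j + k).natAbs := by
    have hj : (0 : ℝ) < (2 ^ j) ^ n := by positivity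
    have h := le_two_mul_half_pow_natAbs (b := r ^ n * a j) (j := j) hn hC hk₁ hk₂
      (by rw [mul_pow]; nlinarith [mul_le_mul_of_nonneg_left (h₁ j) hrn.le])
      (by
        refine le_of_mul_le_mul_right ?_ hj
        calc _ = ((2 : ℝ) ^ j * r) ^ (2 * n) * a j := by ring
          _ ≤ _ := h₂ j)
    rw [div_mul_eq_mul_div, le_div_iff₀ hrn]
    linarith
  have sq_bound (j : ℤ) : a j ^ 2 ≤ (2 * C / r ^ n) ^ 2 * (1 / 4 : ℝ) ^ (j + k).natAbs := by
    refine (pow_le_pow_left₀ (ha j) (bound j) 2).trans_eq ?_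
    rw [mul_pow, ← pow_mul, mul_comm _ 2, pow_mul]
    norm_num
  have hsum : Summable fun j : ℤ => (2 * C / r ^ n) ^ 2 * (1 / 4 : ℝ) ^ (j + k).natAbs :=
    ((Equiv.addRight k).summable_iff.mpr summable_quarter_pow_natAbs).mul_left _
  have hshift : ∑' j : ℤ, (1 / 4 : ℝ) ^ (j + k).natAbs = ∑' m : ℤ, (1 / 4 : ℝ) ^ m.natAbs :=
    (Equiv.addRight k).tsum_eq fun m : ℤ => (1 / 4 : ℝ) ^ m.natAbs
  have htsum : ∑' j, a j ^ 2 ≤ (2 * C / r ^ n) ^ 2 * ∑' m : ℤ, (1 / 4 : ℝ) ^ m.natAbs := by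
    rw [← hshift, ← tsum_mul_left]
    exact (hsum.of_nonneg_of_le (fun j => sq_nonneg _) sq_bound).tsum_le_tsum sq_bound hsum
  rw [← Real.sqrt_eq_rpow]
  refine (Real.sqrt_le_sqrt htsum).trans_eq ?_
  rw [Real.sqrt_mul (sq_nonneg _), Real.sqrt_sq (by positivity)]
  ring

/-- Every point of a segment whose length is at most half the larger of the norms of its
endpoints has norm comparable to the endpoints. -/
lemma norm_add_norm_le_four_mul_of_mem_segment {E : Type*} [NormedAddCommGroup E]
    [NormedSpace ℝ E] {u v w : E} (h : ‖u - v‖ ≤ 1 / 2 * max ‖u‖ ‖v‖)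
    (hw : w ∈ segment ℝ u v) : ‖u‖ + ‖v‖ ≤ 4 * ‖w‖ := by
  have hwu : ‖w - u‖ ≤ ‖u - v‖ := by
    rw [norm_sub_rev u v]; exact norm_sub_le_of_mem_segment hw
  have hwv : ‖w - v‖ ≤ ‖u - v‖ := by
    rw [segment_symm] at hw; exact norm_sub_le_of_mem_segment hw
  have hu : ‖u‖ ≤ ‖w‖ + ‖w - u‖ := by
    simpa [norm_sub_rev] using norm_add_le w (u - w)
  have hv : ‖v‖ ≤ ‖w‖ + ‖w - v‖ := by
    simpa [norm_sub_rev] using norm_add_le w (v - w)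
  rcases max_cases ‖u‖ ‖v‖ with ⟨h', _⟩ | ⟨h', _⟩ <;> rw [h'] at h <;> linarith

lemma norm_dyad {d : ℕ} (Φ : Rd d → ℂ) (j : ℤ) (x : Rd d) :
    ‖dyad Φ j x‖ = ((2 : ℝ) ^ j) ^ d * ‖Φ ((2 : ℝ) ^ j • x)‖ := by
  rw [dyad, norm_mul, Complex.norm_real, Real.norm_of_nonneg (by positivity), zpow_mul,
    zpow_natCast]

lemma norm_dyad_sub {d : ℕ} (Φ : Rd d → ℂ) (j : ℤ) (x y : Rd d) :
    ‖dyad Φ j x - dyad Φ j y‖ =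
      ((2 : ℝ) ^ j) ^ d * ‖Φ ((2 : ℝ) ^ j • x) - Φ ((2 : ℝ) ^ j • y)‖ := by
  rw [dyad, dyad, ← mul_sub, norm_mul, Complex.norm_real, Real.norm_of_nonneg (by positivity),
    zpow_mul, zpow_natCast]

/-- Size estimate for the kernel of dyadic dilates. -/
lemma dyad_size_bound {d : ℕ} (Φ : SchwartzMap (Rd d) ℂ) :
    ∃ N : ℝ, 0 ≤ N ∧ ∀ z : Rd d, z ≠ 0 →
      (∑' j : ℤ, ‖dyad (⇑Φ) j z‖ ^ 2) ^ ((1 : ℝ) / 2) ≤ N / ‖z‖ ^ d := by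
  obtain ⟨A, hA, hA'⟩ := Φ.decay 0 0
  obtain ⟨B, hB, hB'⟩ := Φ.decay (2 * d) 0
  simp only [norm_iteratedFDeriv_zero, pow_zero, one_mul] at hA' hB'
  refine ⟨2 * max A B * √(∑' m : ℤ, (1 / 4 : ℝ) ^ m.natAbs), by positivity, fun z hz => ?_⟩
  have hd : d ≠ 0 := by
    rintro rfl
    exact hz (Subsingleton.elim _ _)
  refine rpow_half_tsum_sq_le hd (norm_pos_iff.mpr hz) (by positivity)
    (fun j => norm_nonneg _) (fun j => ?_) (fun j => ?_)
  · rw [norm_dyad, mul_comm]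
    gcongr
    exact (hA' _).trans (le_max_left _ _)
  · have h := (hB' ((2 : ℝ) ^ j • z)).trans (le_max_right A B)
    rw [norm_smul, Real.norm_of_nonneg (by positivity)] at h
    rw [norm_dyad, mul_left_comm, mul_comm (max A B)]
    gcongr

/-- Smoothness estimate for the kernel of dyadic dilates. -/
lemma dyad_smoothness_bound {d : ℕ} (Φ : SchwartzMap (Rd d) ℂ) :
    ∃ N : ℝ, 0 ≤ N ∧ ∀ u v : Rd d, ‖u - v‖ ≤ 1 / 2 * max ‖u‖ ‖v‖ →
      (∑' j : ℤ, ‖dyad (⇑Φ) j u - dyad (⇑Φ) j v‖ ^ 2) ^ ((1 : ℝ) / 2) ≤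
        N * ‖u - v‖ / (‖u‖ + ‖v‖) ^ (d + 1) := by
  obtain ⟨A, hA, hA'⟩ := Φ.decay 0 1
  obtain ⟨B, hB, hB'⟩ := Φ.decay (2 * (d + 1)) 1
  simp only [norm_iteratedFDeriv_one, pow_zero, one_mul] at hA' hB'
  set C := max A (4 ^ (2 * (d + 1)) * B)
  have hC0 : 0 < C := lt_max_of_lt_left hA
  refine ⟨2 * C * √(∑' m : ℤ, (1 / 4 : ℝ) ^ m.natAbs), by positivity, fun u v huv => ?_⟩
  rcases eq_or_ne u v with rfl | hne
  · simp
  have hr : 0 < ‖u‖ + ‖v‖ := by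
    have := norm_sub_le u v
    have := norm_pos_iff.mpr (sub_ne_zero.mpr hne)
    linarith
  -- the mean value inequality on the dilated segment
  have mvt (j : ℤ) {L : ℝ}
      (hL : ∀ p ∈ segment ℝ ((2 : ℝ) ^ j • u) ((2 : ℝ) ^ j • v), ‖fderiv ℝ Φ p‖ ≤ L) :
      ‖dyad (⇑Φ) j u - dyad (⇑Φ) j v‖ ≤ L * ‖u - v‖ * ((2 : ℝ) ^ j) ^ (d + 1) := by
    have h := (convex_segment _ _).norm_image_sub_le_of_norm_fderiv_le
      (𝕜 := ℝ) (fun p _ => Φ.differentiableAt) hL (right_mem_segment ℝ _ _)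
      (left_mem_segment ℝ _ _)
    rw [← smul_sub, norm_smul, Real.norm_of_nonneg (by positivity)] at h
    rw [norm_dyad_sub]
    calc _ ≤ ((2 : ℝ) ^ j) ^ d * (L * ((2 : ℝ) ^ j * ‖u - v‖)) := by gcongr
      _ = _ := by ring
  have key := rpow_half_tsum_sq_le (n := d + 1) (C := C * ‖u - v‖)
    (a := fun j => ‖dyad (⇑Φ) j u - dyad (⇑Φ) j v‖) d.succ_ne_zero hr (by positivity)
    (fun j => norm_nonneg _) (fun j => mvt j fun p _ => (hA' p).trans (le_max_left _ _))
    (fun j => ?_)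
  · refine key.trans_eq ?_
    ring
  · have hs : 0 < ((2 : ℝ) ^ j * (‖u‖ + ‖v‖)) ^ (2 * (d + 1)) := by positivity
    rw [← le_div_iff₀' hs]
    refine (mvt j (L := C / ((2 : ℝ) ^ j * (‖u‖ + ‖v‖)) ^ (2 * (d + 1))) fun p hp => ?_).trans_eq
      (by ring)
    rw [le_div_iff₀' hs]
    have hnorm (x : Rd d) : ‖(2 : ℝ) ^ j • x‖ = (2 : ℝ) ^ j * ‖x‖ := by
      rw [norm_smul, Real.norm_of_nonneg (by positivity)]
    have hp' := norm_add_norm_le_four_mul_of_mem_segment (by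
      rw [← smul_sub, hnorm, hnorm, hnorm, ← mul_max_of_nonneg _ _ (by positivity),
        mul_left_comm]
      gcongr) hp
    rw [hnorm, hnorm, ← mul_add] at hp'
    calc _ ≤ (4 * ‖p‖) ^ (2 * (d + 1)) * ‖fderiv ℝ Φ p‖ := by gcongr
      _ = 4 ^ (2 * (d + 1)) * (‖p‖ ^ (2 * (d + 1)) * ‖fderiv ℝ Φ p‖) := by ring
      _ ≤ 4 ^ (2 * (d + 1)) * B := by gcongr; exact hB' p
      _ ≤ C := le_max_right _ _

/-- the dyadic dilates of a Schwartz function form an `ℓ₂`-valued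
standard kernel. -/
theorem dyadic_dilates_standard_kernel (d : ℕ) (Φ : SchwartzMap (Rd d) ℂ) :
    ∃ N : ℝ, 0 < N ∧
      (∀ x y : Rd d, x ≠ y →
        (∑' j : ℤ, ‖dyad (⇑Φ) j (x - y)‖ ^ 2) ^ ((1 : ℝ) / 2) ≤ N / ‖x - y‖ ^ (d : ℝ)) ∧
      (∀ x x' y : Rd d, ‖x - x'‖ ≤ (1 / 2) * max ‖x - y‖ ‖x' - y‖ →
        (∑' j : ℤ, ‖dyad (⇑Φ) j (x - y) - dyad (⇑Φ) j (x' - y)‖ ^ 2) ^ ((1 : ℝ) / 2) ≤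
          N * ‖x - x'‖ / (‖x - y‖ + ‖x' - y‖) ^ ((d : ℝ) + 1)) := by
  obtain ⟨N₁, hN₁, h₁⟩ := dyad_size_bound Φ
  obtain ⟨N₂, hN₂, h₂⟩ := dyad_smoothness_bound Φ
  refine ⟨N₁ + N₂ + 1, by positivity, fun x y hxy => ?_, fun x x' y h => ?_⟩
  · refine (h₁ (x - y) (sub_ne_zero.mpr hxy)).trans ?_
    rw [Real.rpow_natCast]
    gcongr
    linarith
  · have hsub : x - y - (x' - y) = x - x' := by abel
    refine (h₂ (x - y) (x' - y) (by rwa [hsub])).trans ?_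
    rw [hsub, ← Nat.cast_add_one, Real.rpow_natCast]
    gcongr
    linarith
end
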